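/- arXiv:2209.14786 — 2 statements merged into one kernel-verified Lean document; each statement's English description precedes it below -/
import Mathlib

section
/- There exist n : ℕ and a finite set S of elements of G := Fin n → Matrix (Fin 3) (Fin 3) ℤ, every coordinate matrix of every element of S being upper unitriangular, such that the membership predicate fun x : G => x ∈ Submonoid.closure S is not a computable predicate (¬ ComputablePred). That is, some sufficiently large finite direct power of the Heisenberg group contains a finitely generated submonoid with algorithmically unsolvable membership problem. -/
/-- A 3×3 integer matrix is upper unitriangular (i.e. lies in the Heisenberg group ℍ). -/
def UpperUnitriangular (m : Matrix (Fin 3) (Fin 3) ℤ) : Prop :=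
  m 0 0 = 1 ∧ m 1 1 = 1 ∧ m 2 2 = 1 ∧ m 1 0 = 0 ∧ m 2 0 = 0 ∧ m 2 1 = 0

instance : Primcodable (Matrix (Fin 3) (Fin 3) ℤ) :=
  inferInstanceAs (Primcodable (Fin 3 → Fin 3 → ℤ))


section ArithmeticFunctions

open Dioph Finset

theorem digit_sum_lt (u : ℕ) (d : ℕ → ℕ) (hd : ∀ i, d i < u) (k : ℕ) :
    ∑ i ∈ range k, d i * u ^ i < u ^ k := by
  induction k with
  | zero => simp
  | succ k ih =>
    rw [sum_range_succ, pow_succ]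
    have := hd k
    have h2 : (d k + 1) * u ^ k ≤ u * u ^ k := Nat.mul_le_mul_right _ this
    nlinarith

theorem choose_formula (n k : ℕ) :
    n.choose k = ((2 ^ n + 1 + 1) ^ n / (2 ^ n + 1) ^ k) % (2 ^ n + 1) := by
  set u := 2 ^ n + 1 with hu
  have hc : ∀ i, n.choose i < u := fun i => by
    have := Nat.choose_le_two_pow n i
    omega
  have hu0 : 0 < u := Nat.succ_pos _
  have key : ∃ q, (u + 1) ^ n =
      ∑ i ∈ range k, n.choose i * u ^ i + u ^ k * (n.choose k + u * q) := by
    have h1 : (u + 1) ^ n = ∑ i ∈ range (n + 1 + (k + 1)), n.choose i * u ^ i := by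
      rw [add_pow, sum_range_add _ (n + 1)]
      rw [sum_eq_zero (s := range (k + 1))]
      · simp [mul_comm]
      · intro i _
        rw [Nat.choose_eq_zero_of_lt (by omega)]
        simp
    refine ⟨∑ i ∈ range (n + 1), n.choose (k + 1 + i) * u ^ i, ?_⟩
    rw [h1, add_comm (n + 1), sum_range_add, sum_range_succ, mul_add, mul_sum, mul_sum, add_assoc]
    congr 1
    congr 1
    · ring
    · refine sum_congr rfl fun i _ => ?_
      ring
  obtain ⟨q, hq⟩ := key
  rw [hq, Nat.add_mul_div_left _ _ (by positivity),
    Nat.div_eq_of_lt (digit_sum_lt u _ hc k), zero_add, Nat.add_mul_mod_self_left,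
    Nat.mod_eq_of_lt (hc k)]

theorem factorial_formula (n : ℕ) :
    n.factorial = (n * n * (n ^ n + 1) + n + 1) ^ n / (n * n * (n ^ n + 1) + n + 1).choose n := by
  set r := n * n * (n ^ n + 1) + n + 1 with hr
  have hnr : n ≤ r := by omega
  have hcpos : 0 < r.choose n := Nat.choose_pos hnr
  have hD : r.descFactorial n = n.factorial * r.choose n :=
    Nat.descFactorial_eq_factorial_mul_choose r n
  have h1 : r.descFactorial n ≤ r ^ n := Nat.descFactorial_le_pow r n
  have h2 : (r - n) ^ n ≤ r.descFactorial n :=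
    le_trans (Nat.pow_le_pow_left (by omega) n) (Nat.pow_sub_le_descFactorial r n)
  have h3 : n.factorial ≤ n ^ n := Nat.factorial_le_pow n
  symm
  apply Nat.div_eq_of_lt_le
  · rw [← hD]; exact h1
  · -- r ^ n < (n! + 1) * choose
    have hb : r ^ n ≤ (r - n) ^ n + n * n * r ^ (n - 1) := by
      obtain ⟨s, hs⟩ : ∃ s, r = s + n := ⟨r - n, by omega⟩
      have : ∀ m : ℕ, (s + n) ^ m ≤ s ^ m + m * n * (s + n) ^ (m - 1) := by
        intro m
        induction m with
        | zero => simp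
        | succ m ih =>
          rcases Nat.eq_zero_or_pos m with rfl | hm
          · simp
          · obtain ⟨l, rfl⟩ : ∃ l, m = l + 1 := ⟨m - 1, by omega⟩
            simp only [Nat.add_sub_cancel] at *
            have hsl : s ^ (l + 1) ≤ (s + n) ^ (l + 1) := Nat.pow_le_pow_left (by omega) _
            have e1 : (s + n) ^ (l + 1 + 1) = (s + n) * (s + n) ^ (l + 1) := by ring
            calc (s + n) ^ (l + 1 + 1) = (s + n) * (s + n) ^ (l + 1) := by ring
              _ ≤ (s + n) * (s ^ (l + 1) + (l + 1) * n * (s + n) ^ l) := Nat.mul_le_mul_left _ ih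
              _ = s ^ (l + 1 + 1) + n * s ^ (l + 1) + (l + 1) * n * (s + n) ^ (l + 1) := by ring
              _ ≤ s ^ (l + 1 + 1) + n * (s + n) ^ (l + 1) + (l + 1) * n * (s + n) ^ (l + 1) := by
                  gcongr
              _ = _ := by ring
      have := this n
      rw [hs, Nat.add_sub_cancel]
      exact this
    rcases Nat.eq_zero_or_pos n with h0 | hn
    · rw [h0]; simp
    have hrn : r ^ n = r * r ^ (n - 1) := by
      rw [← pow_succ']; congr 1; omega
    have hpos : 0 < r ^ (n - 1) := by
      have : 0 < r := by omega
      positivity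
    -- n! * n² r^{n-1} < D
    set X := r ^ (n - 1)
    set F := n.factorial
    set D := r.descFactorial n
    have hX : r ^ n ≤ D + n * n * X := by omega
    have hFpos : 0 < F := Nat.factorial_pos n
    have hlt : F * (n * n * X) < D := by
      have a1 : F * (n * n * X) ≤ n ^ n * (n * n * X) := Nat.mul_le_mul_right _ h3
      have a2 : n ^ n * (n * n * X) + n * n * X < r * X := by
        have : n ^ n * (n * n * X) + n * n * X = (n * n * (n ^ n + 1)) * X := by ring
        rw [this]
        exact Nat.mul_lt_mul_of_pos_right (by omega) hpos
      omega
    have : F * r ^ n < F * ((F + 1) * r.choose n) := by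
      calc F * r ^ n ≤ F * (D + n * n * X) := Nat.mul_le_mul_left _ hX
        _ = F * D + F * (n * n * X) := by ring
        _ < F * D + D := by omega
        _ = F * ((F + 1) * r.choose n) := by rw [hD]; ring
    exact Nat.lt_of_mul_lt_mul_left this

/-- the product `∏_{k=1}^{y} (1 + k t)` -/
def prodSeq (t y : ℕ) : ℕ := ∏ k ∈ range y, (1 + (k + 1) * t)

theorem prodSeq_formula (t y : ℕ) (ht : 0 < t) :
    prodSeq t y = (t ^ y * (y.factorial *
      (t * (1 + y * t) ^ y * (1 + y * t) ^ y + y).choose y)) % (t * (1 + y * t) ^ y + 1) := by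
  set w := (1 + y * t) ^ y with hw
  set q := t * w * w with hq
  have hlt : prodSeq t y < t * w + 1 := by
    have : prodSeq t y ≤ w := by
      have := Finset.prod_le_pow_card (range y) (fun k => 1 + (k + 1) * t) (1 + y * t) (by
        intro k hk
        have : k + 1 ≤ y := by simpa using hk
        have := Nat.mul_le_mul_right t this
        omega)
      simpa [prodSeq] using this
    nlinarith
  have hcong : prodSeq t y ≡ t ^ y * (y.factorial * (q + y).choose y) [MOD (t * w + 1)] := by
    have h1 : (q + y).descFactorial y = y.factorial * (q + y).choose y :=
      Nat.descFactorial_eq_factorial_mul_choose _ _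
    rw [← h1, Nat.add_descFactorial_eq_ascFactorial, Nat.ascFactorial_eq_prod_range]
    have : t ^ y * ∏ i ∈ range y, (q + 1 + i) = ∏ i ∈ range y, (t * (q + 1 + i)) := by
      rw [prod_mul_distrib]; simp
    rw [this]
    unfold prodSeq
    have base : 1 ≡ t * q [MOD (t * w + 1)] := by
      rw [← Int.natCast_modEq_iff, Int.modEq_iff_dvd]
      refine ⟨(t : ℤ) * w - 1, ?_⟩
      rw [hq]; push_cast; ring
    have : ∀ m, ∏ k ∈ range m, (1 + (k + 1) * t) ≡ ∏ i ∈ range m, (t * (q + 1 + i))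
        [MOD (t * w + 1)] := by
      intro m
      induction m with
      | zero => rfl
      | succ m ih =>
        rw [prod_range_succ, prod_range_succ]
        refine ih.mul ?_
        have : t * (q + 1 + m) = t * q + (m + 1) * t := by ring
        rw [this]
        exact base.add_right _
    exact this y
  rw [← Nat.mod_eq_of_lt hlt]
  exact hcong

variable {α : Type} {f g : (α → ℕ) → ℕ}

theorem dioph_choose (df : DiophFn f) (dg : DiophFn g) :
    DiophFn fun v => (f v).choose (g v) := by
  have h2 := pow_dioph (const_dioph (α := α) 2) df
  have h1 := const_dioph (α := α) 1
  have hu := add_dioph h2 h1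
  have := mod_dioph (div_dioph (pow_dioph (add_dioph hu h1) df) (pow_dioph hu dg)) hu
  simp only [choose_formula]
  exact this

theorem dioph_factorial (df : DiophFn f) : DiophFn fun v => (f v).factorial := by
  have h1 := const_dioph (α := α) 1
  have hr := add_dioph (add_dioph (mul_dioph (mul_dioph df df)
    (add_dioph (pow_dioph df df) h1)) df) h1
  have := div_dioph (pow_dioph hr df) (dioph_choose hr df)
  simp only [factorial_formula]
  exact this

theorem dioph_prodSeq_pos (df : DiophFn f) (dg : DiophFn g) (hf : ∀ v, 0 < f v) :
    DiophFn fun v => prodSeq (f v) (g v) := by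
  have h1 := const_dioph (α := α) 1
  have hw := pow_dioph (add_dioph h1 (mul_dioph dg df)) dg
  have htw := mul_dioph df hw
  have hq := mul_dioph htw hw
  have := mod_dioph (mul_dioph (pow_dioph df dg)
    (mul_dioph (dioph_factorial dg) (dioph_choose (add_dioph hq dg) dg))) (add_dioph htw h1)
  have e : (fun v => prodSeq (f v) (g v)) = fun v => _ :=
    funext fun v => prodSeq_formula (f v) (g v) (hf v)
  rw [e]
  exact this

theorem dioph_descFactorial (df : DiophFn f) (dg : DiophFn g) :
    DiophFn fun v => (f v).descFactorial (g v) := by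
  simp only [Nat.descFactorial_eq_factorial_mul_choose]
  exact mul_dioph (dioph_factorial dg) (dioph_choose df dg)

end ArithmeticFunctions


section BoundedQuantifier

open Dioph Finset

theorem dioph_ex {α : Type} {P : ℕ → (α → ℕ) → Prop}
    (h : Dioph {w : Option α → ℕ | P (w none) (w ∘ some)}) : Dioph {v | ∃ x, P x v} :=
  Dioph.ext (ex1_dioph h) fun _ => Iff.rfl

theorem dioph_subst {α : Type} {P : ℕ → (α → ℕ) → Prop} {f : (α → ℕ) → ℕ}
    (h : Dioph {w : Option α → ℕ | P (w none) (w ∘ some)}) (df : DiophFn f) :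
    Dioph {v | P (f v) v} :=
  Dioph.ext (diophFn_comp1 h df) fun _ => Iff.rfl

theorem dioph_forall_finset {α β : Type} (F : Finset β) (S : β → Set (α → ℕ))
    (h : ∀ i, Dioph (S i)) : Dioph {v | ∀ i ∈ F, v ∈ S i} := by
  classical
  induction F using Finset.induction_on with
  | empty =>
    refine Dioph.ext (eq_dioph (const_dioph (α := α) 0) (const_dioph (α := α) 0)) fun v => ?_
    simp
  | insert i F _ ih =>
    refine Dioph.ext (Dioph.inter (h i) ih) fun v => ?_
    simp

theorem poly_finite_support {γ β : Type} (p : Poly (γ ⊕ β)) :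
    ∃ F : Finset β, ∀ x x' : γ ⊕ β → ℕ, (∀ i, x (Sum.inl i) = x' (Sum.inl i)) →
      (∀ i ∈ F, x (Sum.inr i) = x' (Sum.inr i)) → p x = p x' := by
  classical
  induction p using Poly.induction with
  | H1 i =>
    rcases i with i | i
    · exact ⟨∅, fun x x' h _ => by simp [h]⟩
    · exact ⟨{i}, fun x x' _ h => by simp [h]⟩
  | H2 n => exact ⟨∅, fun x x' _ _ => by simp⟩
  | H3 f g hf hg =>
    obtain ⟨F, hF⟩ := hf
    obtain ⟨G, hG⟩ := hg
    refine ⟨F ∪ G, fun x x' h h' => ?_⟩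
    simp only [Poly.sub_apply]
    rw [hF x x' h fun i hi => h' i (by simp [hi]), hG x x' h fun i hi => h' i (by simp [hi])]
  | H4 f g hf hg =>
    obtain ⟨F, hF⟩ := hf
    obtain ⟨G, hG⟩ := hg
    refine ⟨F ∪ G, fun x x' h h' => ?_⟩
    simp only [Poly.mul_apply]
    rw [hF x x' h fun i hi => h' i (by simp [hi]), hG x x' h fun i hi => h' i (by simp [hi])]

theorem poly_bound {γ : Type} (p : Poly γ) :
    ∃ Q : Poly γ, ∀ x x' : γ → ℕ, (∀ i, x i ≤ x' i) → |p x| ≤ Q x' := by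
  induction p using Poly.induction with
  | H1 i => exact ⟨Poly.proj i, fun x x' h => by simpa using h i⟩
  | H2 n => exact ⟨Poly.const |n|, fun x x' h => by simp⟩
  | H3 f g hf hg =>
    obtain ⟨F, hF⟩ := hf
    obtain ⟨G, hG⟩ := hg
    refine ⟨F + G, fun x x' h => ?_⟩
    simp only [Poly.sub_apply, Poly.add_apply]
    exact (abs_sub _ _).trans (add_le_add (hF x x' h) (hG x x' h))
  | H4 f g hf hg =>
    obtain ⟨F, hF⟩ := hf
    obtain ⟨G, hG⟩ := hg
    refine ⟨F * G, fun x x' h => ?_⟩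
    simp only [Poly.mul_apply, abs_mul]
    exact mul_le_mul (hF x x' h) (hG x x' h) (abs_nonneg _) ((abs_nonneg _).trans (hF x x' h))

theorem poly_modEq {γ : Type} (p : Poly γ) (m : ℕ) (x x' : γ → ℕ)
    (h : ∀ i, x i ≡ x' i [MOD m]) : p x ≡ p x' [ZMOD m] := by
  induction p using Poly.induction with
  | H1 i => simpa using (Int.natCast_modEq_iff.2 (h i))
  | H2 n => simp
  | H3 f g hf hg => simpa using hf.sub hg
  | H4 f g hf hg => simpa using hf.mul hg

theorem prod_dvd_of_pairwise_coprime (m : ℕ → ℕ) (y z : ℕ)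
    (hc : ∀ i < y, ∀ j < i, Nat.Coprime (m j) (m i)) (hd : ∀ i < y, m i ∣ z) :
    ∏ k ∈ range y, m k ∣ z := by
  induction y with
  | zero => simp
  | succ y ih =>
    rw [prod_range_succ]
    refine Nat.Coprime.mul_dvd_of_dvd_of_dvd ?_ (ih (fun i hi => hc i (by omega))
      fun i hi => hd i (by omega)) (hd y (by omega))
    exact Nat.Coprime.prod_left fun j hj => hc y (by omega) j (by simpa using hj)

theorem bounded_core {α β : Type} (p : Poly (Option α ⊕ β)) (F : Finset β)
    (hF : ∀ x x' : Option α ⊕ β → ℕ, (∀ i, x (Sum.inl i) = x' (Sum.inl i)) →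
      (∀ i ∈ F, x (Sum.inr i) = x' (Sum.inr i)) → p x = p x')
    (Q : Poly (Option α ⊕ β)) (hQ : ∀ x x' : Option α ⊕ β → ℕ, (∀ i, x i ≤ x' i) → |p x| ≤ Q x')
    (v : α → ℕ) (y : ℕ) (T : ℕ → ℕ)
    (hT : ∀ u, T u =
      ((Q (Sum.elim (Option.elim' y v) fun _ => u)).natAbs + y + 1).factorial) :
    (∀ k, 1 ≤ k → k ≤ y → ∃ t, p (Sum.elim (Option.elim' k v) t) = 0) ↔
    ∃ u c, ∃ a : β → ℕ, 1 + c * T u = prodSeq (T u) y ∧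
      (∀ i ∈ F, prodSeq (T u) y ∣ (a i).descFactorial (u + 1)) ∧
      prodSeq (T u) y ∣ (p (Sum.elim (Option.elim' c v) a)).natAbs := by
  classical
  have hTpos : ∀ u, 0 < T u := fun u => by rw [hT]; exact Nat.factorial_pos _
  have hTdvd : ∀ u k, 1 ≤ k → k ≤ y + 1 → k ∣ T u := fun u k h1 h2 => by
    rw [hT]; exact Nat.dvd_factorial (by omega) (by omega)
  have hmem : ∀ u k, 1 ≤ k → k ≤ y → 1 + k * T u ∣ prodSeq (T u) y := fun u k h1 h2 => by
    have := Finset.dvd_prod_of_mem (fun k => 1 + (k + 1) * T u)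
      (show k - 1 ∈ range y by simp; omega)
    simp only [Nat.sub_add_cancel h1] at this
    exact this
  have hckey : ∀ u c k m, 1 + c * T u = prodSeq (T u) y → 1 ≤ k → k ≤ y → m ∣ 1 + k * T u →
      c ≡ k [MOD m] := by
    intro u c k m hc h1 h2 hm
    have h0 : m ∣ 1 + c * T u := by rw [hc]; exact hm.trans (hmem u k h1 h2)
    have h3 : 1 + c * T u ≡ 1 + k * T u [MOD m] :=
      ((Nat.modEq_zero_iff_dvd).2 h0).trans ((Nat.modEq_zero_iff_dvd).2 hm).symm
    have h4 : c * T u ≡ k * T u [MOD m] := Nat.ModEq.add_left_cancel' 1 h3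
    refine Nat.ModEq.cancel_right_of_coprime ?_ h4
    have hco : Nat.Coprime (1 + k * T u) (T u) := by simp
    exact hco.coprime_dvd_left hm
  constructor
  · intro h
    have h' : ∀ k, ∃ t : β → ℕ, (∀ i, i ∉ F → t i = 0) ∧
        (1 ≤ k → k ≤ y → p (Sum.elim (Option.elim' k v) t) = 0) := by
      intro k
      by_cases hk : 1 ≤ k ∧ k ≤ y
      · obtain ⟨t, ht⟩ := h k hk.1 hk.2
        refine ⟨fun i => if i ∈ F then t i else 0, fun i hi => by simp [hi], fun _ _ => ?_⟩
        rw [← ht]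
        refine hF _ _ (fun i => rfl) fun i hi => ?_
        simp [hi]
      · exact ⟨fun _ => 0, fun _ _ => rfl, fun h1 h2 => absurd ⟨h1, h2⟩ hk⟩
    choose t ht0 ht using h'
    obtain ⟨u, hu⟩ : ∃ u, ∀ k < y, ∀ i ∈ F, t (k + 1) i ≤ u := by
      refine ⟨(range y).sup fun k => F.sup fun i => t (k + 1) i, fun k hk i hi => ?_⟩
      refine le_trans (Finset.le_sup (f := fun i => t (k + 1) i) hi) ?_
      exact Finset.le_sup (f := fun k => F.sup fun i => t (k + 1) i) (by simpa using hk)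
    have hcop : ∀ i < y, ∀ j < i, Nat.Coprime (1 + (j + 1) * T u) (1 + (i + 1) * T u) := by
      intro i hi j hj
      rw [add_comm 1, add_comm 1]
      exact Nat.coprime_mul_succ (hTdvd u _ (by omega) (by omega))
    obtain ⟨c, hc⟩ : ∃ c, prodSeq (T u) y = 1 + c * T u := by
      have : ∀ y, ∃ c, prodSeq (T u) y = 1 + c * T u := by
        intro y
        induction y with
        | zero => exact ⟨0, by simp [prodSeq]⟩
        | succ y ih =>
          obtain ⟨c, hc⟩ := ih
          refine ⟨c + (y + 1) * (1 + c * T u), ?_⟩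
          unfold prodSeq at *
          rw [prod_range_succ, hc]
          ring
      exact this y
    have hcrt : ∀ i, ∃ a, (∀ k < y, a ≡ t (k + 1) i [MOD (1 + (k + 1) * T u)]) ∧
        (i ∉ F → a = 0) := by
      intro i
      by_cases hi : i ∈ F
      · obtain ⟨a, ha⟩ := Nat.chineseRemainderOfFinset (fun k => t (k + 1) i)
          (fun k => 1 + (k + 1) * T u) (range y) (by intro k _; omega) (by
            intro i hi j hj hij
            have hi' : i < y := by simpa using hi
            have hj' : j < y := by simpa using hj
            rcases lt_or_gt_of_ne hij with hlt | hlt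
            · exact hcop j hj' i hlt
            · exact (hcop i hi' j hlt).symm)
        exact ⟨a, fun k hk => ha k (by simpa using hk), fun h => absurd hi h⟩
      · exact ⟨0, fun k _ => by rw [ht0 _ _ hi], fun _ => rfl⟩
    choose a ha ha0 using hcrt
    refine ⟨u, c, a, hc.symm, fun i hi => ?_, ?_⟩
    · refine prod_dvd_of_pairwise_coprime _ _ _ hcop fun k hk => ?_
      by_cases hau : a i < u + 1
      · rw [Nat.descFactorial_eq_zero_iff_lt.2 hau]; exact dvd_zero _
      · rw [Nat.descFactorial_eq_prod_range]
        have hle := hu k hk i hi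
        refine dvd_trans ?_ (Finset.dvd_prod_of_mem _
          (show t (k + 1) i ∈ range (u + 1) by simp; omega))
        exact (Nat.modEq_iff_dvd' (by omega)).1 (ha i k hk).symm
    · refine prod_dvd_of_pairwise_coprime _ _ _ hcop fun k hk => ?_
      have h1 : p (Sum.elim (Option.elim' c v) a) ≡
          p (Sum.elim (Option.elim' (k + 1) v) (t (k + 1))) [ZMOD ((1 + (k + 1) * T u : ℕ))] := by
        refine poly_modEq p _ _ _ fun i => ?_
        rcases i with (_ | i) | i
        · exact hckey u c (k + 1) _ hc.symm (by omega) (by omega) dvd_rfl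
        · exact Nat.ModEq.refl _
        · exact ha i k hk
      rw [ht (k + 1) (by omega) (by omega)] at h1
      exact Int.natCast_dvd.1 (Int.modEq_zero_iff_dvd.1 h1)
  · rintro ⟨u, c, a, hc, hdesc, hp⟩ k hk1 hk2
    set m := 1 + k * T u with hm
    have hm1 : m ≠ 1 := by
      have := Nat.mul_pos hk1 (hTpos u)
      omega
    set P := m.minFac with hP
    have hPp : P.Prime := Nat.minFac_prime hm1
    have hPm : P ∣ m := Nat.minFac_dvd m
    have hPprod : P ∣ prodSeq (T u) y := hPm.trans (hmem u k hk1 hk2)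
    have hj : ∀ i, ∃ j, j ≤ u ∧ (i ∈ F → a i ≡ j [MOD P]) ∧ (i ∉ F → j = 0) := by
      intro i
      by_cases hi : i ∈ F
      · by_cases hau : a i ≤ u
        · exact ⟨a i, hau, fun _ => rfl, fun h => absurd hi h⟩
        · have := hPprod.trans (hdesc i hi)
          rw [Nat.descFactorial_eq_prod_range, Prime.dvd_finsetProd_iff hPp.prime] at this
          obtain ⟨j, hj, hjd⟩ := this
          have hju : j < u + 1 := by simpa using hj
          exact ⟨j, by omega, fun _ => ((Nat.modEq_iff_dvd' (by omega)).2 hjd).symm,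
            fun h => absurd hi h⟩
      · exact ⟨0, by omega, fun h => absurd h hi, fun _ => rfl⟩
    choose t htu hta ht0 using hj
    refine ⟨t, ?_⟩
    have e1 : p (Sum.elim (Option.elim' c v) a) =
        p (Sum.elim (Option.elim' c v) fun i => if i ∈ F then a i else 0) :=
      hF _ _ (fun i => rfl) fun i hi => by simp [hi]
    have h1 : p (Sum.elim (Option.elim' c v) a) ≡
        p (Sum.elim (Option.elim' k v) t) [ZMOD P] := by
      rw [e1]
      refine poly_modEq p _ _ _ fun i => ?_
      rcases i with (_ | i) | i
      · exact hckey u c k _ hc hk1 hk2 hPm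
      · exact Nat.ModEq.refl _
      · by_cases hi : i ∈ F
        · simpa [hi] using hta i hi
        · simp [hi, ht0 i hi, Nat.ModEq.refl]
    have h2 : (P : ℤ) ∣ p (Sum.elim (Option.elim' c v) a) := Int.natCast_dvd.2 (hPprod.trans hp)
    have h3 : (P : ℤ) ∣ p (Sum.elim (Option.elim' k v) t) :=
      Int.modEq_zero_iff_dvd.1 (h1.symm.trans (Int.modEq_zero_iff_dvd.2 h2))
    have hbd : |p (Sum.elim (Option.elim' k v) t)| ≤
        Q (Sum.elim (Option.elim' y v) fun _ => u) := by
      apply hQ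
      rintro ((_ | i) | i)
      · exact hk2
      · exact le_rfl
      · exact htu i
    have hPbig : (Q (Sum.elim (Option.elim' y v) fun _ => u)).natAbs < P := by
      by_contra hcon
      have hPT : P ∣ T u := by
        rw [hT]; exact Nat.dvd_factorial hPp.pos (by omega)
      have : P ∣ 1 := (Nat.dvd_add_left (hPT.mul_left k)).1 hPm
      exact hPp.one_lt.ne' (Nat.dvd_one.1 this)
    refine Int.eq_zero_of_abs_lt_dvd h3 ?_
    omega

theorem dioph_forall_Icc {α : Type} {S : Set (Option α → ℕ)} (d : Dioph S) :
    Dioph {w : Option α → ℕ | ∀ k, 1 ≤ k → k ≤ w none → Option.elim' k (w ∘ some) ∈ S} := by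
  obtain ⟨β, p, hp⟩ := d
  obtain ⟨F, hF⟩ := poly_finite_support p
  obtain ⟨Q, hQ⟩ := poly_bound p
  -- variables: `Option α ⊕ Option (Option β)`
  let σQ : Option α ⊕ β → Option α ⊕ Option (Option β) :=
    Sum.elim Sum.inl (fun _ => Sum.inr none)
  let σp : Option α ⊕ β → Option α ⊕ Option (Option β) :=
    Sum.elim (Option.elim' (Sum.inr (some none)) fun a => Sum.inl (some a))
      (fun i => Sum.inr (some (some i)))
  let T : (Option α ⊕ Option (Option β) → ℕ) → ℕ := fun x =>
    ((Q.map σQ x).natAbs + x (Sum.inl none) + 1).factorial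
  have dT : DiophFn T :=
    dioph_factorial (add_dioph (add_dioph (abs_poly_dioph _) (proj_dioph _)) (const_dioph 1))
  have dPr : DiophFn fun x => prodSeq (T x) (x (Sum.inl none)) :=
    dioph_prodSeq_pos dT (proj_dioph _) fun x => Nat.factorial_pos _
  have d1 := eq_dioph (add_dioph (const_dioph 1) (mul_dioph (proj_dioph (Sum.inr (some none))) dT))
    dPr
  have d2 := dioph_forall_finset F _ fun i => dvd_dioph dPr
    (dioph_descFactorial (proj_dioph (Sum.inr (some (some i))))
      (add_dioph (proj_dioph (Sum.inr none)) (const_dioph 1)))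
  have d3 := dvd_dioph dPr (abs_poly_dioph (p.map σp))
  refine Dioph.ext (ex_dioph (Dioph.inter d1 (Dioph.inter d2 d3))) fun w => ?_
  have core := bounded_core p F hF Q hQ (w ∘ some) (w none) _ (fun u => rfl)
  have e1 : ∀ k : ℕ, Option.elim' k (w ∘ some) ∈ S ↔
    ∃ t, p (Sum.elim (Option.elim' k (w ∘ some)) t) = 0 := fun k => hp _
  simp only [Set.mem_ofPred_eq, e1, core]
  have eQ : ∀ x : Option (Option β) → ℕ, (Sum.elim w x) ∘ σQ =
      Sum.elim (Option.elim' (w none) (w ∘ some)) fun _ => x none := by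
    intro x; funext i; rcases i with (_ | i) | i <;> rfl
  have ep : ∀ x : Option (Option β) → ℕ, (Sum.elim w x) ∘ σp =
      Sum.elim (Option.elim' (x (some none)) (w ∘ some)) fun i => x (some (some i)) := by
    intro x; funext i; rcases i with (_ | i) | i <;> rfl
  constructor
  · rintro ⟨x, h1, h2, h3⟩
    refine ⟨x none, x (some none), fun i => x (some (some i)), ?_⟩
    simp only [Set.mem_ofPred_eq, T, Poly.map_apply, eQ, ep] at h1 h2 h3
    exact ⟨h1, h2, h3⟩
  · rintro ⟨u, c, a, h1, h2, h3⟩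
    refine ⟨Option.elim' u (Option.elim' c a), ?_, ?_, ?_⟩
    · simp only [Set.mem_ofPred_eq, T, Poly.map_apply, eQ]
      exact h1
    · simp only [Set.mem_ofPred_eq, T, Poly.map_apply, eQ]
      exact h2
    · simp only [Set.mem_ofPred_eq, T, Poly.map_apply, eQ, ep]
      exact h3

theorem dioph_forall_lt {α : Type} {P : ℕ → (α → ℕ) → Prop} {f : (α → ℕ) → ℕ}
    (h : Dioph {w : Option α → ℕ | P (w none) (w ∘ some)}) (df : DiophFn f) :
    Dioph {v | ∀ k < f v, P k v} := by
  have h1 : Dioph {w : Option α → ℕ | P (w none - 1) (w ∘ some)} := by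
    have h2 := reindex_dioph (Option (Option α)) (Option.map some) h
    have := dioph_subst (α := Option α) (P := fun x w => P x (w ∘ some)) (f := fun w => w none - 1)
      h2 (sub_dioph (proj_dioph _) (const_dioph 1))
    exact this
  have h3 := diophFn_comp1 (dioph_forall_Icc h1) df
  refine Dioph.ext h3 fun v => ?_
  constructor
  · intro H k hk
    exact H (k + 1) (by omega) hk
  · intro H k hk1 hk2
    exact H (k - 1) (by change k ≤ f v at hk2; omega)

end BoundedQuantifier


section PartialRecursive

open Dioph

theorem dioph_and {α : Type} {A B : (α → ℕ) → Prop} (hA : Dioph {v | A v}) (hB : Dioph {v | B v}) :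
    Dioph {v | A v ∧ B v} := Dioph.inter hA hB

theorem dioph_or {α : Type} {A B : (α → ℕ) → Prop} (hA : Dioph {v | A v}) (hB : Dioph {v | B v}) :
    Dioph {v | A v ∨ B v} := Dioph.union hA hB

theorem diophFn_weaken {α : Type} {f : (α → ℕ) → ℕ} (df : DiophFn f) :
    DiophFn fun w : Option α → ℕ => f (w ∘ some) := reindex_diophFn some df

theorem diophFn_pair {α : Type} {f g : (α → ℕ) → ℕ} (df : DiophFn f) (dg : DiophFn g) :
    DiophFn fun v => Nat.pair (f v) (g v) := by
  have df' := diophFn_weaken df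
  have dg' := diophFn_weaken dg
  have dn := proj_dioph (none : Option α)
  refine Dioph.ext (dioph_or
    (dioph_and (lt_dioph df' dg') (eq_dioph (add_dioph (mul_dioph dg' dg') df') dn))
    (dioph_and (le_dioph dg' df') (eq_dioph
      (add_dioph (add_dioph (mul_dioph df' df') df') dg') dn))) fun w => ?_
  simp only [Set.mem_ofPred_eq, Nat.pair]
  split_ifs with h
  · simp [h]
  · simp [h, not_lt.1 h]

theorem diophFn_unpair_fst {α : Type} {f : (α → ℕ) → ℕ} (df : DiophFn f) :
    DiophFn fun v => (f v).unpair.1 := by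
  refine Dioph.ext (dioph_ex (P := fun b (w : Option α → ℕ) =>
    Nat.pair (w none) b = f (w ∘ some)) (eq_dioph
      (diophFn_pair (proj_dioph _) (proj_dioph _))
      (diophFn_weaken (diophFn_weaken df)))) fun w => ?_
  simp only [Set.mem_ofPred_eq]
  constructor
  · rintro ⟨b, hb⟩
    rw [← hb]; simp
  · intro h
    exact ⟨(f (w ∘ some)).unpair.2, by rw [← h, Nat.pair_unpair]⟩

theorem diophFn_unpair_snd {α : Type} {f : (α → ℕ) → ℕ} (df : DiophFn f) :
    DiophFn fun v => (f v).unpair.2 := by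
  refine Dioph.ext (dioph_ex (P := fun b (w : Option α → ℕ) =>
    Nat.pair b (w none) = f (w ∘ some)) (eq_dioph
      (diophFn_pair (proj_dioph _) (proj_dioph _))
      (diophFn_weaken (diophFn_weaken df)))) fun w => ?_
  simp only [Set.mem_ofPred_eq]
  constructor
  · rintro ⟨b, hb⟩
    rw [← hb]; simp
  · intro h
    exact ⟨(f (w ∘ some)).unpair.1, by rw [← h, Nat.pair_unpair]⟩

theorem diophFn_beta {α : Type} {f g : (α → ℕ) → ℕ} (df : DiophFn f) (dg : DiophFn g) :
    DiophFn fun v => Nat.beta (f v) (g v) :=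
  mod_dioph (diophFn_unpair_fst df)
    (add_dioph (mul_dioph (add_dioph dg (const_dioph 1)) (diophFn_unpair_snd df)) (const_dioph 1))

theorem exists_beta (h : ℕ → ℕ) (n : ℕ) : ∃ s, ∀ i ≤ n, Nat.beta s i = h i := by
  refine ⟨Nat.unbeta ((List.range (n + 1)).map h), fun i hi => ?_⟩
  have := Nat.beta_unbeta_coe ((List.range (n + 1)).map h) ⟨i, by simp; omega⟩
  simpa using this

/-- A partial function is Diophantine-definable, in a form convenient for substitution. -/
def DiophGraph (F : ℕ →. ℕ) : Prop :=
  ∀ {α : Type} {f g : (α → ℕ) → ℕ}, DiophFn f → DiophFn g → Dioph {v | g v ∈ F (f v)}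

theorem mem_prec_iff (f g : ℕ →. ℕ) (a n y : ℕ) :
    (y ∈ (n.rec (f a) fun y IH => do let i ← IH; g (Nat.pair a (Nat.pair y i)) : Part ℕ)) ↔
    ∃ s, Nat.beta s 0 ∈ f a ∧
      (∀ k < n, Nat.beta s (k + 1) ∈ g (Nat.pair a (Nat.pair k (Nat.beta s k)))) ∧
      Nat.beta s n = y := by
  have key : (y ∈ (n.rec (f a) fun y IH => do let i ← IH; g (Nat.pair a (Nat.pair y i)) : Part ℕ)) ↔
    ∃ h : ℕ → ℕ, h 0 ∈ f a ∧
      (∀ k < n, h (k + 1) ∈ g (Nat.pair a (Nat.pair k (h k)))) ∧ h n = y := by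
    induction n generalizing y with
    | zero =>
      constructor
      · intro h
        exact ⟨fun _ => y, h, by simp, rfl⟩
      · rintro ⟨h, h0, -, rfl⟩
        exact h0
    | succ n ih =>
      constructor
      · intro h
        obtain ⟨i, hi, hy⟩ := Part.mem_bind_iff.1 h
        obtain ⟨h, h0, hk, hn⟩ := (ih i).1 hi
        refine ⟨fun m => if m = n + 1 then y else h m, by simpa using h0, fun k hkn => ?_, by simp⟩
        rcases Nat.lt_succ_iff_lt_or_eq.1 hkn with hlt | rfl
        · have e1 : k + 1 ≠ n + 1 := by omega
          have e2 : k ≠ n + 1 := by omega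
          simp only [e1, e2, if_false]
          exact hk k hlt
        · simp only [if_true]
          rw [if_neg (by omega), hn]
          exact hy
      · rintro ⟨h, h0, hk, rfl⟩
        refine Part.mem_bind_iff.2 ⟨h n, (ih (h n)).2 ⟨h, h0, fun k hkn => hk k (by omega), rfl⟩, ?_⟩
        exact hk n (by omega)
  rw [key]
  constructor
  · rintro ⟨h, h0, hk, hn⟩
    obtain ⟨s, hs⟩ := exists_beta h n
    refine ⟨s, by rwa [hs 0 (by omega)], fun k hkn => ?_, by rwa [hs n le_rfl]⟩
    rw [hs _ hkn, hs _ hkn.le]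
    exact hk k hkn
  · rintro ⟨s, h0, hk, hn⟩
    exact ⟨Nat.beta s, h0, hk, hn⟩

theorem diophGraph_of_partrec {F : ℕ →. ℕ} (hF : Nat.Partrec F) : DiophGraph F := by
  induction hF with
  | zero =>
    intro α f g df dg
    refine Dioph.ext (eq_dioph dg (const_dioph 0)) fun v => ?_
    simp [pure, PFun.pure]
  | succ =>
    intro α f g df dg
    refine Dioph.ext (eq_dioph dg (add_dioph df (const_dioph 1))) fun v => ?_
    simp [PFun.coe_val]
  | left =>
    intro α f g df dg
    refine Dioph.ext (eq_dioph dg (diophFn_unpair_fst df)) fun v => ?_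
    simp [PFun.coe_val]
  | right =>
    intro α f g df dg
    refine Dioph.ext (eq_dioph dg (diophFn_unpair_snd df)) fun v => ?_
    simp [PFun.coe_val]
  | @pair F G _ _ hF hG =>
    intro α f g df dg
    refine Dioph.ext (dioph_ex (P := fun a v => ∃ b, a ∈ F (f v) ∧ b ∈ G (f v) ∧ Nat.pair a b = g v)
      (dioph_ex (P := fun b (w : Option α → ℕ) => w none ∈ F (f (w ∘ some)) ∧
          b ∈ G (f (w ∘ some)) ∧ Nat.pair (w none) b = g (w ∘ some))
        (dioph_and (hF (diophFn_weaken (diophFn_weaken df)) (proj_dioph _))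
          (dioph_and (hG (diophFn_weaken (diophFn_weaken df)) (proj_dioph _))
            (eq_dioph (diophFn_pair (proj_dioph _) (proj_dioph _))
              (diophFn_weaken (diophFn_weaken dg))))))) fun v => ?_
    simp [Seq.seq]
  | @comp F G _ _ hF hG =>
    intro α f g df dg
    refine Dioph.ext (dioph_ex (P := fun a v => a ∈ G (f v) ∧ g v ∈ F a)
      (dioph_and (hG (diophFn_weaken df) (proj_dioph _))
        (hF (proj_dioph _) (diophFn_weaken dg)))) fun v => ?_
    exact Part.mem_bind_iff.symm
  | @prec F G _ _ hF hG =>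
    intro α f g df dg
    have da := diophFn_unpair_fst df
    have dn := diophFn_unpair_snd df
    refine Dioph.ext (dioph_ex (P := fun s v => Nat.beta s 0 ∈ F (f v).unpair.1 ∧
      (∀ k < (f v).unpair.2, Nat.beta s (k + 1) ∈
        G (Nat.pair (f v).unpair.1 (Nat.pair k (Nat.beta s k)))) ∧
      Nat.beta s (f v).unpair.2 = g v)
      (dioph_and (hF (diophFn_weaken da) (diophFn_beta (proj_dioph _) (const_dioph 0)))
        (dioph_and (dioph_forall_lt (P := fun k (w : Option α → ℕ) =>
            Nat.beta (w none) (k + 1) ∈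
              G (Nat.pair (f (w ∘ some)).unpair.1 (Nat.pair k (Nat.beta (w none) k))))
            (hG (diophFn_pair (diophFn_weaken (diophFn_weaken da))
                (diophFn_pair (proj_dioph _) (diophFn_beta (proj_dioph _) (proj_dioph _))))
              (diophFn_beta (proj_dioph _) (add_dioph (proj_dioph _) (const_dioph 1))))
            (diophFn_weaken dn))
          (eq_dioph (diophFn_beta (proj_dioph _) (diophFn_weaken dn)) (diophFn_weaken dg)))))
      fun v => ?_
    exact (mem_prec_iff F G _ _ _).symm
  | @rfind F _ hF =>
    intro α f g df dg
    refine Dioph.ext (dioph_and (A := fun v => 0 ∈ F (Nat.pair (f v) (g v)))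
      (B := fun v => ∀ k < g v, ∃ z, z ∈ F (Nat.pair (f v) k) ∧ z ≠ 0)
      (hF (diophFn_pair df dg) (const_dioph 0))
      (dioph_forall_lt (P := fun k v => ∃ z, z ∈ F (Nat.pair (f v) k) ∧ z ≠ 0)
        (dioph_ex (P := fun z (w : Option α → ℕ) =>
            z ∈ F (Nat.pair (f (w ∘ some)) (w none)) ∧ z ≠ 0)
          (dioph_and (hF (diophFn_pair (diophFn_weaken (diophFn_weaken df)) (proj_dioph _))
            (proj_dioph _)) (ne_dioph (proj_dioph _) (const_dioph 0)))) dg)) fun v => ?_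
    refine Iff.trans ?_ Nat.mem_rfind.symm
    simp

end PartialRecursive


section Circuits

open Dioph

/-- Natural-number polynomial terms. -/
inductive NTm (γ : Type) : Type
  | var (i : γ) : NTm γ
  | const (c : ℕ) : NTm γ
  | add (a b : NTm γ) : NTm γ
  | mul (a b : NTm γ) : NTm γ

/-- Evaluation of terms. -/
def NTm.eval {γ : Type} (v : γ → ℕ) : NTm γ → ℕ
  | .var i => v i
  | .const c => c
  | .add a b => a.eval v + b.eval v
  | .mul a b => a.eval v * b.eval v

/-- List of subterms. -/
def NTm.subs {γ : Type} : NTm γ → List (NTm γ)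
  | .var i => [.var i]
  | .const c => [.const c]
  | .add a b => .add a b :: (a.subs ++ b.subs)
  | .mul a b => .mul a b :: (a.subs ++ b.subs)

theorem NTm.self_mem_subs {γ : Type} (a : NTm γ) : a ∈ a.subs := by
  cases a <;> simp [NTm.subs]

/-- A list of terms is closed under taking subterms. -/
def SubClosed {γ : Type} (l : List (NTm γ)) : Prop :=
  (∀ a b, NTm.add a b ∈ l → a ∈ l ∧ b ∈ l) ∧ (∀ a b, NTm.mul a b ∈ l → a ∈ l ∧ b ∈ l)

theorem SubClosed.append {γ : Type} {l l' : List (NTm γ)} (h : SubClosed l) (h' : SubClosed l') :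
    SubClosed (l ++ l') := by
  constructor
  · intro a b hab
    rcases List.mem_append.1 hab with hm | hm
    · have := h.1 a b hm; simp [this]
    · have := h'.1 a b hm; simp [this]
  · intro a b hab
    rcases List.mem_append.1 hab with hm | hm
    · have := h.2 a b hm; simp [this]
    · have := h'.2 a b hm; simp [this]

theorem NTm.subClosed_subs {γ : Type} (a : NTm γ) : SubClosed a.subs := by
  induction a with
  | var i => constructor <;> simp [NTm.subs]
  | const c => constructor <;> simp [NTm.subs]
  | add a b iha ihb =>
    have h := iha.append ihb
    constructor
    · intro c d hcd
      rcases List.mem_cons.1 hcd with he | hm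
      · injection he with h1 h2
        subst h1 h2
        simp [NTm.subs, NTm.self_mem_subs]
      · have := h.1 c d hm
        exact ⟨List.mem_cons_of_mem _ this.1, List.mem_cons_of_mem _ this.2⟩
    · intro c d hcd
      rcases List.mem_cons.1 hcd with he | hm
      · cases he
      · have := h.2 c d hm
        exact ⟨List.mem_cons_of_mem _ this.1, List.mem_cons_of_mem _ this.2⟩
  | mul a b iha ihb =>
    have h := iha.append ihb
    constructor
    · intro c d hcd
      rcases List.mem_cons.1 hcd with he | hm
      · cases he
      · have := h.1 c d hm
        exact ⟨List.mem_cons_of_mem _ this.1, List.mem_cons_of_mem _ this.2⟩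
    · intro c d hcd
      rcases List.mem_cons.1 hcd with he | hm
      · injection he with h1 h2
        subst h1 h2
        simp [NTm.subs, NTm.self_mem_subs]
      · have := h.2 c d hm
        exact ⟨List.mem_cons_of_mem _ this.1, List.mem_cons_of_mem _ this.2⟩

theorem poly_eq_sub {γ : Type} (p : Poly γ) :
    ∃ s t : NTm γ, ∀ v, p v = (s.eval v : ℤ) - (t.eval v : ℤ) := by
  induction p using Poly.induction with
  | H1 i => exact ⟨.var i, .const 0, fun v => by simp [NTm.eval]⟩
  | H2 n => exact ⟨.const n.toNat, .const (-n).toNat, fun v => by simp [NTm.eval]⟩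
  | H3 f g hf hg =>
    obtain ⟨s, t, h⟩ := hf
    obtain ⟨s', t', h'⟩ := hg
    refine ⟨.add s t', .add t s', fun v => ?_⟩
    simp only [Poly.sub_apply, h, h', NTm.eval]
    push_cast; ring
  | H4 f g hf hg =>
    obtain ⟨s, t, h⟩ := hf
    obtain ⟨s', t', h'⟩ := hg
    refine ⟨.add (.mul s s') (.mul t t'), .add (.mul s t') (.mul t s'), fun v => ?_⟩
    simp only [Poly.mul_apply, h, h', NTm.eval]
    push_cast; ring

/-- Gates of an arithmetic circuit. -/
inductive Gate (V : Type) : Type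
  | free : Gate V
  | const (c : ℕ) : Gate V
  | add (i j : V) : Gate V
  | mul (i j : V) : Gate V

/-- The value `x` is consistent with the gate. -/
def Gate.Holds {V : Type} (v : V → ℕ) (x : ℕ) : Gate V → Prop
  | .free => True
  | .const c => x = c
  | .add i j => x = v i + v j
  | .mul i j => x = v i * v j

/-- The gate of a term in a subterm closed list. -/
def NTm.gate {γ : Type} {l : List (NTm γ)} (hl : SubClosed l) :
    (a : NTm γ) → a ∈ l → Gate {a : NTm γ // a ∈ l}
  | .var _, _ => .free
  | .const c, _ => .const c
  | .add a b, h => .add ⟨a, (hl.1 a b h).1⟩ ⟨b, (hl.1 a b h).2⟩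
  | .mul a b, h => .mul ⟨a, (hl.2 a b h).1⟩ ⟨b, (hl.2 a b h).2⟩

theorem exists_circuit {S : Set (Unit → ℕ)} (d : Dioph S) :
    ∃ (V : Type) (_ : Finite V) (node : V → Gate V) (s t x₀ : V), ∀ n : ℕ,
      (fun _ => n) ∈ S ↔
        ∃ v : V → ℕ, (∀ i, (node i).Holds v (v i)) ∧ v s = v t ∧ v x₀ = n := by
  classical
  obtain ⟨β, p, hp⟩ := d
  obtain ⟨s, t, hst⟩ := poly_eq_sub p
  let X : NTm (Unit ⊕ β) := .var (Sum.inl ())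
  let l := s.subs ++ (t.subs ++ X.subs)
  have hl : SubClosed l :=
    (NTm.subClosed_subs s).append ((NTm.subClosed_subs t).append (NTm.subClosed_subs X))
  have hs : s ∈ l := by simp [l, NTm.self_mem_subs]
  have ht : t ∈ l := by simp [l, NTm.self_mem_subs]
  have hX : X ∈ l := by simp [l, NTm.self_mem_subs]
  refine ⟨{a : NTm (Unit ⊕ β) // a ∈ l}, List.finite_toSet l, fun a => NTm.gate hl a.1 a.2,
    ⟨s, hs⟩, ⟨t, ht⟩, ⟨X, hX⟩, fun n => ?_⟩
  rw [hp]
  constructor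
  · rintro ⟨b, hb⟩
    refine ⟨fun a => a.1.eval (Sum.elim (fun _ => n) b), ?_, ?_, rfl⟩
    · rintro ⟨a, ha⟩
      cases a <;> simp [NTm.gate, Gate.Holds, NTm.eval]
    · rw [hst] at hb
      simp only
      omega
  · rintro ⟨v, hv, hvst, hvx⟩
    let w : Unit ⊕ β → ℕ := fun i => if h : NTm.var i ∈ l then v ⟨.var i, h⟩ else 0
    have key : ∀ (a : NTm (Unit ⊕ β)) (ha : a ∈ l), v ⟨a, ha⟩ = a.eval w := by
      intro a
      induction a with
      | var i => intro ha; simp [NTm.eval, w, ha]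
      | const c => intro ha; exact hv ⟨_, ha⟩
      | add a b iha ihb =>
        intro ha
        have h := hv ⟨_, ha⟩
        simp only [NTm.gate, Gate.Holds] at h
        rw [h, iha, ihb]; rfl
      | mul a b iha ihb =>
        intro ha
        have h := hv ⟨_, ha⟩
        simp only [NTm.gate, Gate.Holds] at h
        rw [h, iha, ihb]; rfl
    refine ⟨w ∘ Sum.inr, ?_⟩
    have hw : Sum.elim (fun _ => n) (w ∘ Sum.inr) = w := by
      funext i
      rcases i with i | i
      · have := key X hX
        simp only [Sum.elim_inl]
        rw [← hvx, this]; rfl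
      · rfl
    rw [hw, hst, ← key s hs, ← key t ht, hvst, sub_self]

end Circuits


section HeisenbergWords

/-- Heisenberg matrices. -/
def heis (a b c : ℤ) : Matrix (Fin 3) (Fin 3) ℤ := !![1, a, c; 0, 1, b; 0, 0, 1]

theorem heis_mul (a b c a' b' c' : ℤ) :
    heis a b c * heis a' b' c' = heis (a + a') (b + b') (c + c' + a * b') := by
  ext i j
  fin_cases i <;> fin_cases j <;> simp [heis, Matrix.mul_apply, Fin.sum_univ_three] <;> ring

theorem heis_one : heis 0 0 0 = 1 := by
  ext i j
  fin_cases i <;> fin_cases j <;> simp [heis]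

theorem heis_inj {a b c a' b' c' : ℤ} : heis a b c = heis a' b' c' ↔ a = a' ∧ b = b' ∧ c = c' := by
  constructor
  · intro h
    refine ⟨?_, ?_, ?_⟩
    · simpa [heis] using congrFun (congrFun h 0) 1
    · simpa [heis] using congrFun (congrFun h 1) 2
    · simpa [heis] using congrFun (congrFun h 0) 2
  · rintro ⟨rfl, rfl, rfl⟩; rfl

variable {Γ : Type}

/-- Sum of weights along a word. -/
def sm (f : Γ → ℤ) (w : List Γ) : ℤ := (w.map f).sum

/-- Sum over ordered pairs of positions. -/
def cross (A B : Γ → ℤ) : List Γ → ℤ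
  | [] => 0
  | g :: w => cross A B w + A g * sm B w

@[simp] theorem sm_nil (f : Γ → ℤ) : sm f [] = 0 := rfl
@[simp] theorem sm_cons (f : Γ → ℤ) (g : Γ) (w : List Γ) : sm f (g :: w) = f g + sm f w := by
  simp [sm]
@[simp] theorem sm_append (f : Γ → ℤ) (w w' : List Γ) : sm f (w ++ w') = sm f w + sm f w' := by
  simp [sm]
theorem sm_add (f f' : Γ → ℤ) (w : List Γ) : sm (f + f') w = sm f w + sm f' w := by
  induction w with
  | nil => simp
  | cons g w ih => simp [ih]; ring
theorem sm_sub (f f' : Γ → ℤ) (w : List Γ) : sm (f - f') w = sm f w - sm f' w := by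
  induction w with
  | nil => simp
  | cons g w ih => simp [ih]; ring
theorem sm_neg (f : Γ → ℤ) (w : List Γ) : sm (-f) w = - sm f w := by
  induction w with
  | nil => simp
  | cons g w ih => simp [ih]; ring
@[simp] theorem sm_zero (w : List Γ) : sm (0 : Γ → ℤ) w = 0 := by
  induction w with
  | nil => simp
  | cons g w ih => simp [ih]

theorem sm_eq_zero {f : Γ → ℤ} {w : List Γ} (h : ∀ g ∈ w, f g = 0) : sm f w = 0 := by
  induction w with
  | nil => simp
  | cons g w ih => simp [h g, ih fun g hg => h g (List.mem_cons_of_mem _ hg)]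

theorem cross_append (A B : Γ → ℤ) (w w' : List Γ) :
    cross A B (w ++ w') = cross A B w + cross A B w' + sm A w * sm B w' := by
  induction w with
  | nil => simp [cross]
  | cons g w ih => simp [cross, ih]; ring

theorem cross_sub_left (A A' B : Γ → ℤ) (w : List Γ) :
    cross (A - A') B w = cross A B w - cross A' B w := by
  induction w with
  | nil => simp [cross]
  | cons g w ih => simp [cross, ih]; ring

theorem cross_sub_right (A B B' : Γ → ℤ) (w : List Γ) :
    cross A (B - B') w = cross A B w - cross A B' w := by
  induction w with
  | nil => simp [cross]
  | cons g w ih => simp [cross, ih, sm_sub]; ring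

theorem cross_zero_left (B : Γ → ℤ) (w : List Γ) : cross 0 B w = 0 := by
  induction w with
  | nil => simp [cross]
  | cons g w ih => simp [cross, ih]

theorem cross_eq_zero_left {A B : Γ → ℤ} {w : List Γ} (h : ∀ g ∈ w, A g = 0) :
    cross A B w = 0 := by
  induction w with
  | nil => simp [cross]
  | cons g w ih => simp [cross, h g, ih fun g hg => h g (List.mem_cons_of_mem _ hg)]

theorem cross_eq_zero_right {A B : Γ → ℤ} {w : List Γ} (h : ∀ g ∈ w, B g = 0) :
    cross A B w = 0 := by
  induction w with
  | nil => simp [cross]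
  | cons g w ih =>
    have h' : ∀ g ∈ w, B g = 0 := fun g hg => h g (List.mem_cons_of_mem _ hg)
    simp [cross, ih h', sm_eq_zero h']

theorem cross_symm {A B : Γ → ℤ} (h : ∀ g, A g * B g = 0) (w : List Γ) :
    cross A B w + cross B A w = sm A w * sm B w := by
  induction w with
  | nil => simp [cross]
  | cons g w ih =>
    simp only [cross, sm_cons]
    have := h g
    linear_combination ih - this

theorem heis_prod (A B C : Γ → ℤ) (w : List Γ) :
    (w.map fun g => heis (A g) (B g) (C g)).prod =
      heis (sm A w) (sm B w) (sm C w + cross A B w) := by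
  induction w with
  | nil => simp [cross, heis_one]
  | cons g w ih =>
    simp only [List.map_cons, List.prod_cons, ih, heis_mul, sm_cons, cross]
    congr 1
    ring

variable [DecidableEq Γ]

/-- Indicator weight. -/
def ind (g : Γ) : Γ → ℤ := fun h => if h = g then 1 else 0

@[simp] theorem ind_self (g : Γ) : ind g g = 1 := by simp [ind]
theorem ind_ne {g h : Γ} (hne : h ≠ g) : ind g h = 0 := by simp [ind, hne]

theorem ind_eq_zero_of_not_mem {g : Γ} {w : List Γ} (h : g ∉ w) : ∀ x ∈ w, ind g x = 0 :=
  fun _ hx => ind_ne fun he => h (he ▸ hx)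

theorem sm_ind (g : Γ) (w : List Γ) : sm (ind g) w = (w.count g : ℤ) := by
  induction w with
  | nil => simp
  | cons h w ih =>
    by_cases hg : h = g
    · subst hg; simp [ih]; ring
    · simp [ih, ind_ne hg, List.count_cons_of_ne hg]

/-- If all `s'` come before `t` and all `s` after `t`, no `s` precedes an `s'`. -/
theorem cross_ind_zero {s s' t : Γ} {w₁ w₂ : List Γ} (hs : s ∉ w₁) (hs' : s' ∉ w₂) (ht : t ≠ s) :
    cross (ind s) (ind s') (w₁ ++ t :: w₂) = 0 := by
  rw [cross_append, cross, sm_eq_zero (ind_eq_zero_of_not_mem hs),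
    cross_eq_zero_left (ind_eq_zero_of_not_mem hs),
    cross_eq_zero_right (ind_eq_zero_of_not_mem hs'), ind_ne ht]
  ring

theorem cross_marker {t : Γ} {w₁ w₂ : List Γ} (h₁ : t ∉ w₁) (h₂ : t ∉ w₂) (B : Γ → ℤ) :
    cross (ind t) B (w₁ ++ t :: w₂) = sm B w₂ := by
  rw [cross_append, cross, sm_eq_zero (ind_eq_zero_of_not_mem h₁),
    cross_eq_zero_left (ind_eq_zero_of_not_mem h₁),
    cross_eq_zero_left (ind_eq_zero_of_not_mem h₂), ind_self]
  ring

end HeisenbergWords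


section Encoding

variable {V : Type} [DecidableEq V]

/-- The generators: four copies of every variable and three markers. -/
inductive Gen (V : Type) : Type
  | v (i : V) (p : Fin 4)
  | m (q : Fin 3)
  deriving DecidableEq

instance [Finite V] : Finite (Gen V) :=
  Finite.of_surjective (fun x : (V × Fin 4) ⊕ Fin 3 => match x with
    | .inl y => Gen.v y.1 y.2
    | .inr q => Gen.m q) (by
      rintro (⟨i, p⟩ | q)
      · exact ⟨.inl (i, p), rfl⟩
      · exact ⟨.inr q, rfl⟩)

/-- The coordinates: order constraints, gates, and two global equations. -/
abbrev Coord (V : Type) : Type := (V × Fin 4) ⊕ (V ⊕ Bool)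

/-- The generator for copy `p` of the variable `i`. -/
abbrev vgen (i : V) (p : Fin 4) : Gen V := Gen.v i p

/-- The marker generators. -/
abbrev mgen (q : Fin 3) : Gen V := Gen.m q

/-- marker used by an order constraint -/
def ordM : Fin 4 → Fin 3 := ![0, 1, 2, 0]
/-- copy which must come before the marker -/
def ordB : Fin 4 → Fin 4 := ![0, 1, 2, 0]
/-- copy which must come after the marker -/
def ordA : Fin 4 → Fin 4 := ![1, 2, 3, 3]

/-- A triple of weights. -/
structure Wt (Γ : Type) where
  /-- upper left weight -/
  A : Γ → ℤ
  /-- lower right weight -/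
  B : Γ → ℤ
  /-- central weight -/
  C : Γ → ℤ

/-- Weights of a gate coordinate. -/
def gateWt (i : V) : Gate V → Wt (Gen V)
  | .free => ⟨0, 0, 0⟩
  | .const _ => ⟨0, 0, ind (vgen i 0)⟩
  | .add j k => ⟨0, 0, ind (vgen i 0) - ind (vgen j 0) - ind (vgen k 0)⟩
  | .mul j k => ⟨ind (vgen j 1) - ind (vgen j 3), ind (vgen k 2) - ind (vgen k 0),
      - ind (vgen i 0)⟩

/-- Target of a gate coordinate. -/
def gateTg : Gate V → ℤ
  | .const c => c
  | _ => 0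

/-- Weights of all coordinates. -/
def wts (node : V → Gate V) (s t x₀ : V) : Coord V → Wt (Gen V)
  | .inl (i, o) => ⟨ind (mgen (ordM o)), ind (vgen i (ordA o)) - ind (vgen i (ordB o)),
      - ind (vgen i (ordA o))⟩
  | .inr (.inl i) => gateWt i (node i)
  | .inr (.inr false) => ⟨0, 0, ind (vgen s 0) - ind (vgen t 0)⟩
  | .inr (.inr true) => ⟨0, 0, ind (vgen x₀ 0)⟩

/-- First entry of the targets. -/
def tgA : Coord V → ℤ
  | .inl _ => 1
  | .inr _ => 0

/-- Central entry of the targets. -/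
def tgC (node : V → Gate V) (n : ℕ) : Coord V → ℤ
  | .inl _ => 0
  | .inr (.inl i) => gateTg (node i)
  | .inr (.inr false) => 0
  | .inr (.inr true) => n

/-- The word `w` hits the target in the given coordinate. -/
def Hits (W : Wt (Gen V)) (a c : ℤ) (w : List (Gen V)) : Prop :=
  sm W.A w = a ∧ sm W.B w = 0 ∧ sm W.C w + cross W.A W.B w = c

/-- Normal words for the variable assignment `v`. -/
def Good (v : V → ℕ) (w : List (Gen V)) : Prop :=
  (∀ i p, w.count (vgen i p) = v i) ∧
  ∀ q : Fin 3, ∃ w₁ w₂, w = w₁ ++ mgen q :: w₂ ∧ mgen q ∉ w₁ ∧ mgen q ∉ w₂ ∧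
    ∀ o, ordM o = q → ∀ i, vgen i (ordA o) ∉ w₁ ∧ vgen i (ordB o) ∉ w₂

theorem good_of_hits (node : V → Gate V) (s t x₀ : V) (w : List (Gen V))
    (h : ∀ i o, Hits (wts node s t x₀ (.inl (i, o))) 1 0 w) :
    Good (fun i => w.count (vgen i 0)) w := by
  have hB : ∀ i o, w.count (vgen i (ordA o)) = w.count (vgen i (ordB o)) := by
    intro i o
    have := (h i o).2.1
    simp only [wts, sm_sub, sm_ind] at this
    omega
  refine ⟨fun i p => ?_, fun q => ?_⟩
  · have h0 := hB i 0
    have h1 := hB i 1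
    have h2 := hB i 2
    simp only [ordA, ordB] at h0 h1 h2
    simp at h0 h1 h2
    fin_cases p
    · rfl
    · exact h0
    · exact h1.trans h0
    · exact h2.trans (h1.trans h0)
  · have hq : w.count (mgen q) = 1 := by
      obtain ⟨o, ho⟩ : ∃ o, ordM o = q := by
        fin_cases q
        · exact ⟨0, rfl⟩
        · exact ⟨1, rfl⟩
        · exact ⟨2, rfl⟩
      have := (h x₀ o).1
      simp only [wts, sm_ind, ho] at this
      exact_mod_cast this
    have hmem : mgen q ∈ w := List.count_pos_iff.1 (by omega)
    obtain ⟨w₁, w₂, hw⟩ := List.append_of_mem hmem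
    rw [hw, List.count_append, List.count_cons_self] at hq
    have n1 : mgen q ∉ w₁ := List.count_eq_zero.1 (by omega)
    have n2 : mgen q ∉ w₂ := List.count_eq_zero.1 (by omega)
    refine ⟨w₁, w₂, hw, n1, n2, fun o ho i => ?_⟩
    have h3 := (h i o).2.2
    have h2 := hB i o
    simp only [wts, ho] at h3
    rw [hw] at h3
    rw [cross_marker n1 n2, sm_neg, sm_sub, sm_append, sm_cons, ind_ne (by simp)] at h3
    simp only [sm_ind] at h3
    constructor
    · refine List.count_eq_zero.1 ?_
      omega
    · refine List.count_eq_zero.1 ?_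
      omega

theorem hits_of_good (node : V → Gate V) (s t x₀ : V) (v : V → ℕ) (w : List (Gen V))
    (hg : Good v w) (i : V) (o : Fin 4) :
    Hits (wts node s t x₀ (.inl (i, o))) 1 0 w := by
  obtain ⟨hc, hq⟩ := hg
  obtain ⟨w₁, w₂, hw, n1, n2, ho⟩ := hq (ordM o)
  obtain ⟨m1, m2⟩ := ho o rfl i
  refine ⟨?_, ?_, ?_⟩
  · simp only [wts, sm_ind]
    rw [hw, List.count_append, List.count_cons_self, List.count_eq_zero.2 n1,
      List.count_eq_zero.2 n2]
    rfl
  · simp only [wts, sm_sub, sm_ind, hc]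
    ring
  · have e := hc i (ordA o)
    simp only [wts]
    rw [sm_neg, sm_ind]
    rw [hw] at e ⊢
    rw [List.count_append, List.count_cons_of_ne (by simp)] at e ⊢
    rw [cross_marker n1 n2, sm_sub, sm_ind, sm_ind, List.count_eq_zero.2 m1,
      List.count_eq_zero.2 m2]
    push_cast
    ring

theorem cross_good {v : V → ℕ} {w : List (Gen V)} (hg : Good v w) (o o' : Fin 4)
    (hoo : ordM o = ordM o') (i j : V) :
    cross (ind (vgen i (ordA o))) (ind (vgen j (ordB o'))) w = 0 := by
  obtain ⟨w₁, w₂, hw, n1, n2, ho⟩ := hg.2 (ordM o)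
  rw [hw]
  exact cross_ind_zero (ho o rfl i).1 (ho o' hoo.symm j).2 (by simp)

theorem gate_hits_iff {v : V → ℕ} {w : List (Gen V)} (hg : Good v w) (i : V) (G : Gate V) :
    Hits (gateWt i G) 0 (gateTg G) w ↔ G.Holds v (v i) := by
  cases G with
  | free => simp [Hits, gateWt, gateTg, Gate.Holds, cross_zero_left]
  | const c =>
    simp [Hits, gateWt, gateTg, Gate.Holds, cross_zero_left, sm_ind, hg.1]
  | add j k =>
    simp only [Hits, gateWt, gateTg, Gate.Holds, cross_zero_left, sm_ind, hg.1, sm_zero, sm_sub, true_and, add_zero]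
    omega
  | mul j k =>
    have c10 : cross (ind (vgen j 1)) (ind (vgen k 0)) w = 0 := cross_good hg 0 0 rfl j k
    have c32 : cross (ind (vgen j 3)) (ind (vgen k 2)) w = 0 := cross_good hg 2 2 rfl j k
    have c30 : cross (ind (vgen j 3)) (ind (vgen k 0)) w = 0 := cross_good hg 3 0 rfl j k
    have c21 : cross (ind (vgen k 2)) (ind (vgen j 1)) w = 0 := cross_good hg 1 1 rfl k j
    have c12 : cross (ind (vgen j 1)) (ind (vgen k 2)) w = (v j : ℤ) * v k := by
      have := cross_symm (A := ind (vgen j 1)) (B := ind (vgen k 2)) (by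
        intro g
        by_cases h : g = vgen j 1
        · have : g ≠ vgen k 2 := by rw [h]; simp
          rw [ind_ne this, mul_zero]
        · rw [ind_ne h, zero_mul]) w
      rw [c21, sm_ind, sm_ind, hg.1, hg.1, add_zero] at this
      exact this
    simp only [Hits, gateWt, gateTg, Gate.Holds, sm_ind, hg.1, sm_sub, sm_neg, cross_sub_left,
      cross_sub_right, c10, c32, c30, c12]
    constructor
    · rintro ⟨-, -, h⟩
      have : (v i : ℤ) = v j * v k := by linarith
      exact_mod_cast this
    · intro h
      refine ⟨by ring, by ring, ?_⟩
      rw [h]; push_cast; ring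

theorem exists_good [Fintype V] (v : V → ℕ) : ∃ w : List (Gen V), Good v w := by
  let blk : Fin 4 → List (Gen V) := fun p =>
    (Finset.univ : Finset V).toList.flatMap fun i => List.replicate (v i) (vgen i p)
  have hm : ∀ p q, (mgen q : Gen V) ∉ blk p := by
    intro p q h
    simp [blk] at h
  have hv : ∀ p p' i, p ≠ p' → vgen i p ∉ blk p' := by
    intro p p' i hne h
    simp [blk] at h
    exact hne h.2
  have hcount : ∀ p i, (blk p).count (vgen i p) = v i := by
    intro p i
    simp only [blk, List.count_flatMap, Function.comp_def, List.count_replicate]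
    rw [Finset.sum_map_toList, Finset.sum_eq_single i]
    · simp
    · intro b _ hb
      simp [hb]
    · simp
  refine ⟨blk 0 ++ mgen 0 :: (blk 1 ++ mgen 1 :: (blk 2 ++ mgen 2 :: blk 3)), ?_, ?_⟩
  · intro i p
    simp only [List.count_append]
    rw [List.count_cons_of_ne (by simp), List.count_append, List.count_cons_of_ne (by simp),
      List.count_append, List.count_cons_of_ne (by simp)]
    have hz : ∀ p', p ≠ p' → (blk p').count (vgen i p) = 0 := fun p' h =>
      List.count_eq_zero.2 (hv p p' i h)
    have h0 := hcount p i
    fin_cases p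
    · rw [hz 1 (by decide), hz 2 (by decide), hz 3 (by decide)]; exact h0
    · rw [hz 0 (by decide), hz 2 (by decide), hz 3 (by decide)]; simpa using h0
    · rw [hz 0 (by decide), hz 1 (by decide), hz 3 (by decide)]; simpa using h0
    · rw [hz 0 (by decide), hz 1 (by decide), hz 2 (by decide)]; simpa using h0
  · intro q
    fin_cases q
    · refine ⟨blk 0, blk 1 ++ mgen 1 :: (blk 2 ++ mgen 2 :: blk 3), rfl, hm _ _, ?_, ?_⟩
      · simp [hm]
      · intro o ho i
        fin_cases o <;> simp [ordM] at ho <;> simp [ordA, ordB, hv]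
    · refine ⟨blk 0 ++ mgen 0 :: blk 1, blk 2 ++ mgen 2 :: blk 3, by simp, ?_, ?_, ?_⟩
      · simp [hm]
      · simp [hm]
      · intro o ho i
        fin_cases o <;> simp [ordM] at ho <;> simp [ordA, ordB, hv]
    · refine ⟨blk 0 ++ mgen 0 :: (blk 1 ++ mgen 1 :: blk 2), blk 3, by simp, ?_, ?_, ?_⟩
      · simp [hm]
      · simp [hm]
      · intro o ho i
        fin_cases o <;> simp [ordM] at ho <;> simp [ordA, ordB, hv]

theorem exists_word_iff [Fintype V] (node : V → Gate V) (s t x₀ : V) (n : ℕ) :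
    (∃ w : List (Gen V), ∀ k, Hits (wts node s t x₀ k) (tgA k) (tgC node n k) w) ↔
    ∃ v : V → ℕ, (∀ i, (node i).Holds v (v i)) ∧ v s = v t ∧ v x₀ = n := by
  have heq : ∀ (v : V → ℕ) w, Good v w → (Hits (wts node s t x₀ (.inr (.inr false))) 0 0 w ↔
      v s = v t) := by
    intro v w hg
    simp only [Hits, wts, cross_zero_left, sm_ind, hg.1, sm_zero, sm_sub, true_and, add_zero]
    omega
  have hinp : ∀ (v : V → ℕ) w, Good v w → (Hits (wts node s t x₀ (.inr (.inr true))) 0 n w ↔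
      v x₀ = n) := by
    intro v w hg
    simp only [Hits, wts, cross_zero_left, sm_ind, hg.1, sm_zero, true_and, add_zero]
    omega
  constructor
  · rintro ⟨w, hw⟩
    have hg := good_of_hits node s t x₀ w fun i o => hw (.inl (i, o))
    refine ⟨fun i => w.count (vgen i 0), fun i => ?_, (heq _ w hg).1 (hw (.inr (.inr false))),
      (hinp _ w hg).1 (hw (.inr (.inr true)))⟩
    exact (gate_hits_iff hg i (node i)).1 (hw (.inr (.inl i)))
  · rintro ⟨v, hv, hst, hx⟩
    obtain ⟨w, hg⟩ := exists_good v
    refine ⟨w, ?_⟩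
    rintro (⟨i, o⟩ | (i | (_ | _)))
    · exact hits_of_good node s t x₀ v w hg i o
    · exact (gate_hits_iff hg i (node i)).2 (hv i)
    · exact (heq v w hg).2 hst
    · exact (hinp v w hg).2 hx

end Encoding

section Final

open Nat.Partrec

theorem primrec_int_ofNat : Primrec fun n : ℕ => (n : ℤ) := by
  refine Primrec.encode_iff.1 ?_
  exact (Primrec.nat_mul.comp (Primrec.const 2) Primrec.id).of_eq fun n => rfl

theorem primrec_of_coords {σ : Type} [Primcodable σ] {m : ℕ} {f : ℕ → Fin m → σ}
    (h : ∀ k, Primrec fun n => f n k) : Primrec f := by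
  have h2 : Primrec₂ fun (k : Fin m) (n : ℕ) => f n k := Primrec.fin_curry₁.2 h
  exact Primrec.fin_curry.2 (Primrec₂.swap h2)

theorem mem_closure_range_iff {M Γ : Type} [Monoid M] (f : Γ → M) (x : M) :
    x ∈ Submonoid.closure (Set.range f) ↔ ∃ w : List Γ, (w.map f).prod = x := by
  constructor
  · intro h
    induction h using Submonoid.closure_induction with
    | mem x hx =>
      obtain ⟨g, rfl⟩ := hx
      exact ⟨[g], by simp⟩
    | one => exact ⟨[], by simp⟩
    | mul x y _ _ hx hy =>
      obtain ⟨w, rfl⟩ := hx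
      obtain ⟨w', rfl⟩ := hy
      exact ⟨w ++ w', by simp⟩
  · rintro ⟨w, rfl⟩
    refine Submonoid.list_prod_mem _ fun y hy => ?_
    obtain ⟨g, _, rfl⟩ := List.mem_map.1 hy
    exact Submonoid.subset_closure ⟨g, rfl⟩

theorem exists_undecidable_circuit :
    ∃ (V : Type) (_ : Finite V) (node : V → Gate V) (s t x₀ : V),
      ¬ ComputablePred fun n : ℕ =>
        ∃ v : V → ℕ, (∀ i, (node i).Holds v (v i)) ∧ v s = v t ∧ v x₀ = n := by
  let F : ℕ →. ℕ := fun n => Code.eval (Denumerable.ofNat Code n) 0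
  have hF : Nat.Partrec F :=
    Partrec.nat_iff.1 (Code.eval_part.comp (Computable.ofNat Code) (Computable.const 0))
  have hd : Dioph {v : Unit → ℕ | ∃ y, y ∈ F (v ())} :=
    dioph_ex (P := fun y (v : Unit → ℕ) => y ∈ F (v ()))
      (diophGraph_of_partrec hF (Dioph.proj_dioph (some ())) (Dioph.proj_dioph none))
  obtain ⟨V, hV, node, s, t, x₀, h⟩ := exists_circuit hd
  refine ⟨V, hV, node, s, t, x₀, fun hc => ?_⟩
  refine ComputablePred.halting_problem 0 (ComputablePred.computable_of_manyOneReducible ?_ hc)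
  refine ⟨Encodable.encode, Computable.encode, fun c => ?_⟩
  beta_reduce
  rw [← h]
  simp only [Set.mem_ofPred_eq, F, Denumerable.ofNat_encode, Part.dom_iff_mem]

end Final

/-- Theorem 2: some finite direct power of the Heisenberg group contains a finitely generated
submonoid whose membership problem is algorithmically unsolvable. -/
theorem exists_heisenberg_power_submonoid_undecidable_membership :
    ∃ (n : ℕ) (S : Finset (Fin n → Matrix (Fin 3) (Fin 3) ℤ)),
      (∀ g ∈ S, ∀ i, UpperUnitriangular (g i)) ∧
      ¬ ComputablePred (fun x : Fin n → Matrix (Fin 3) (Fin 3) ℤ =>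
          x ∈ Submonoid.closure (S : Set (Fin n → Matrix (Fin 3) (Fin 3) ℤ))) := by
  classical
  obtain ⟨V, hV, node, s, t, x₀, hund⟩ := exists_undecidable_circuit
  have : Fintype V := Fintype.ofFinite V
  have : Fintype (Gen V) := Fintype.ofFinite _
  let N := Fintype.card (Coord V)
  let e : Coord V ≃ Fin N := Fintype.equivFin _
  let gen : Gen V → Fin N → Matrix (Fin 3) (Fin 3) ℤ := fun g k =>
    heis ((wts node s t x₀ (e.symm k)).A g) ((wts node s t x₀ (e.symm k)).B g)
      ((wts node s t x₀ (e.symm k)).C g)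
  refine ⟨N, Finset.univ.image gen, ?_, fun hc => hund ?_⟩
  · intro g hg i
    obtain ⟨γ, -, rfl⟩ := Finset.mem_image.1 hg
    simp [UpperUnitriangular, gen, heis]
  · let target : ℕ → Fin N → Matrix (Fin 3) (Fin 3) ℤ := fun n k =>
      heis (tgA (e.symm k)) 0 (tgC node n (e.symm k))
    refine ComputablePred.computable_of_manyOneReducible ?_ hc
    refine ⟨target, ?_, fun n => ?_⟩
    · refine Primrec.to_comp ?_
      refine primrec_of_coords fun k => ?_
      refine primrec_of_coords fun i => ?_
      refine primrec_of_coords fun j => ?_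
      have hC : Primrec fun n => tgC node n (e.symm k) := by
        rcases e.symm k with p | (i | (_ | _))
        · exact Primrec.const _
        · exact Primrec.const _
        · exact Primrec.const _
        · exact primrec_int_ofNat
      simp only [target]
      fin_cases i <;> fin_cases j <;> simp only [heis] <;>
        first
          | exact Primrec.const _
          | exact hC
    · beta_reduce
      rw [Finset.coe_image, Finset.coe_univ, Set.image_univ, mem_closure_range_iff,
        ← exists_word_iff node s t x₀ n]
      refine exists_congr fun w => ?_
      have hprod : ∀ k, (w.map gen).prod k =
          heis (sm (wts node s t x₀ (e.symm k)).A w) (sm (wts node s t x₀ (e.symm k)).B w)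
            (sm (wts node s t x₀ (e.symm k)).C w +
              cross (wts node s t x₀ (e.symm k)).A (wts node s t x₀ (e.symm k)).B w) := by
        intro k
        rw [← heis_prod]
        have hgen := map_list_prod (Pi.evalMonoidHom (fun _ : Fin N =>
          Matrix (Fin 3) (Fin 3) ℤ) k) (w.map gen)
        rw [List.map_map] at hgen
        exact hgen
      rw [funext_iff]
      simp only [hprod, target, heis_inj]
      constructor
      · intro h k
        exact h (e.symm k)
      · intro h k
        have := h (e k)
        simp only [Equiv.symm_apply_apply] at this
        exact this
end

section
/- Let G and N be groups and μ : G →* N a surjective group homomorphism whose kernel is a finitely generated subgroup. If M is a finitely generated submonoid of N, then the full preimage Submonoid.comap μ M is a finitely generated submonoid of G. -/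
/-- If `μ : G →* N` is a surjective group homomorphism with finitely generated kernel and
`M` is a finitely generated submonoid of `N`, then the full preimage of `M` in `G` is a
finitely generated submonoid. -/
theorem submonoid_comap_fg_of_surjective_of_ker_fg
    {G N : Type*} [Group G] [Group N] (μ : G →* N) (hμ : Function.Surjective μ)
    (hker : μ.ker.FG) (M : Submonoid N) (hM : M.FG) :
    (M.comap μ).FG := by
  rw [Subgroup.fg_iff_submonoid_fg, Submonoid.fg_iff] at hker
  rw [Submonoid.fg_iff] at hM ⊢
  obtain ⟨K, hK, hKf⟩ := hker
  obtain ⟨S, hS, hSf⟩ := hM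
  have hmap : (Submonoid.closure (Function.surjInv hμ '' S)).map μ = M := by
    rw [MonoidHom.map_mclosure, ← hS, Set.image_image]
    simp [Function.surjInv_eq]
  refine ⟨Function.surjInv hμ '' S ∪ K, ?_, (hSf.image _).union hKf⟩
  rw [Submonoid.closure_union, hK]
  apply le_antisymm
  · refine sup_le (Submonoid.map_le_iff_le_comap.1 hmap.le) ?_
    intro x hx
    have hx' : μ x = 1 := hx
    rw [Submonoid.mem_comap, hx']
    exact M.one_mem
  · intro x hx
    rw [Submonoid.mem_comap, ← hmap] at hx
    obtain ⟨y, hy, hyx⟩ := hx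
    have hk : y⁻¹ * x ∈ μ.ker.toSubmonoid := by
      change μ (y⁻¹ * x) = 1
      rw [map_mul, map_inv, hyx, inv_mul_cancel]
    have := Submonoid.mul_mem_sup hy hk
    rwa [mul_inv_cancel_left] at this
end
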